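/- Let B(x,y) = 1 + \sum_{u=1}^{k} \sum_{v=c}^{d} B_{u,v} x^u y^v, where k \ge 1 and 1 \le c \le d, be a bivariate real polynomial satisfying B_{u,v} \ge 0 for all 1 \le u \le k, c \le v \le d. Fix positive rationals \xi and \theta, and suppose the set of positive integers \ell such that \xi\ell \in \mathbb{Z}, \theta\ell \in \mathbb{Z} and Coeff[(B(x,y))^{\ell}, x^{\xi\ell} y^{\theta\ell}] > 0 is nonempty. Then the limit \lim_{\ell \to \infty} (1/\ell) \log Coeff[(B(x,y))^{\ell}, x^{\xi\ell} y^{\theta\ell}] (taken along those \ell) exists and equals the maximum of \sum_{(i,j) \in S} \eta_{i,j} \log(B_{i,j} / \eta_{i,j}) over all vectors \eta = (\eta_{i,j})_{(i,j) \in S} subject to the constraints \sum_{(i,j) \in S} \eta_{i,j} = 1, \sum_{(i,j) \in S} i \eta_{i,j} = \xi, \sum_{(i,j) \in S} j \eta_{i,j} = \theta and \eta_{i,j} \ge 0 for all (i,j) \in S, where S = \{(i,j) \in \mathbb{Z}^2 : B_{i,j} > 0\} (with B_{0,0} = 1). -/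

import Mathlib

open Filter Topology

/-- The coefficient of `x^u y^v` in a bivariate polynomial
`B ∈ ℝ[x,y]`, modelled as `MvPolynomial (Fin 2) ℝ` with `x` the variable `0`
and `y` the variable `1`. -/
noncomputable def bivarCoeff (B : MvPolynomial (Fin 2) ℝ) (u v : ℕ) : ℝ :=
  MvPolynomial.coeff (Finsupp.single 0 u + Finsupp.single 1 v) B


namespace BM

lemma log_factorial_bounds (n : ℕ) :
    (n : ℝ) * Real.log n - n ≤ Real.log (n.factorial : ℝ) ∧
    Real.log (n.factorial : ℝ) ≤ (n : ℝ) * Real.log n - n + (Real.log ((n : ℝ) + 1) + 1) := by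
  rcases Nat.eq_zero_or_pos n with rfl | hn
  · simp
  constructor
  · have h := Real.pow_div_factorial_le_exp (x := (n : ℝ)) (by positivity) n
    have hf : (0 : ℝ) < (n.factorial : ℝ) := by exact_mod_cast n.factorial_pos
    have hn' : (0 : ℝ) < n := by exact_mod_cast hn
    have h2 := Real.log_le_log (by positivity) h
    rw [Real.log_exp, Real.log_div (by positivity) hf.ne', Real.log_pow] at h2
    linarith
  · have key : Real.log (n.factorial : ℝ) ≤ (n : ℝ) * Real.log n - n + (Real.log (n : ℝ) + 1) := by
      induction n, hn using Nat.le_induction with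
      | base => simp
      | succ n hn ih =>
        have hn' : (0 : ℝ) < n := by exact_mod_cast hn
        have hf : (0 : ℝ) < (n.factorial : ℝ) := by exact_mod_cast n.factorial_pos
        rw [Nat.factorial_succ]
        push_cast
        rw [Real.log_mul (by positivity) hf.ne']
        have h3 := Real.one_sub_inv_le_log_of_pos (x := ((n : ℝ) + 1) / n) (by positivity)
        rw [Real.log_div (by positivity) (by positivity)] at h3
        have h4 : 1 - (((n : ℝ) + 1) / n)⁻¹ = 1 / ((n : ℝ) + 1) := by field_simp; ring
        rw [h4, div_le_iff₀ (by positivity)] at h3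
        nlinarith
    have hn' : (0 : ℝ) < n := by exact_mod_cast hn
    have := Real.log_le_log hn' (by linarith : (n : ℝ) ≤ n + 1)
    linarith

/-- the continuous form of the entropy functional -/
noncomputable def F (T : Finset (ℕ × ℕ)) (b η : ℕ × ℕ → ℝ) : ℝ :=
  ∑ p ∈ T, (η p * Real.log (b p) + Real.negMulLog (η p))

lemma F_continuous (T : Finset (ℕ × ℕ)) (b : ℕ × ℕ → ℝ) : Continuous (F T b) := by
  unfold F
  refine continuous_finsetSum _ fun p _ => ?_
  exact ((continuous_apply p).mul continuous_const).add
    (Real.continuous_negMulLog.comp (continuous_apply p))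

lemma F_eq (T : Finset (ℕ × ℕ)) (b η : ℕ × ℕ → ℝ) (h : ∀ p, b p = 0 → η p = 0) :
    ∑ p ∈ T, η p * Real.log (b p / η p) = F T b η := by
  unfold F
  refine Finset.sum_congr rfl fun p _ => ?_
  by_cases h1 : η p = 0
  · simp [h1]
  · have h2 : b p ≠ 0 := fun h0 => h1 (h p h0)
    rw [Real.log_div h2 h1, Real.negMulLog]
    ring

noncomputable def term (T : Finset (ℕ × ℕ)) (b : ℕ × ℕ → ℝ) (m : ℕ × ℕ → ℕ) : ℝ :=
  (Nat.multinomial T m : ℝ) * ∏ p ∈ T, b p ^ m p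

lemma log_term (T : Finset (ℕ × ℕ)) (b : ℕ × ℕ → ℝ) (m : ℕ × ℕ → ℕ) (ℓ : ℕ)
    (hm : ∑ p ∈ T, m p = ℓ) (hl : 0 < ℓ) (hb : ∀ p ∈ T, m p ≠ 0 → 0 < b p) :
    0 < term T b m ∧
    (ℓ : ℝ) * F T b (fun p => (m p : ℝ) / ℓ) - T.card * (Real.log ((ℓ : ℝ) + 1) + 1) ≤
      Real.log (term T b m) ∧
    Real.log (term T b m) ≤ (ℓ : ℝ) * F T b (fun p => (m p : ℝ) / ℓ) +
      (Real.log ((ℓ : ℝ) + 1) + 1) := by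
  have hl' : (0 : ℝ) < ℓ := by exact_mod_cast hl
  have hpw : ∀ p ∈ T, 0 < b p ^ m p := by
    intro p hp
    by_cases h : m p = 0
    · simp [h]
    · exact pow_pos (hb p hp h) _
  have hmul : (0 : ℝ) < (Nat.multinomial T m : ℝ) := by
    exact_mod_cast Nat.multinomial_pos T m
  have hprod : 0 < ∏ p ∈ T, b p ^ m p := Finset.prod_pos hpw
  have hspec := Nat.multinomial_spec T m
  rw [hm] at hspec
  have hspec' : (∏ p ∈ T, ((m p).factorial : ℝ)) * (Nat.multinomial T m : ℝ) =
    (ℓ.factorial : ℝ) := by exact_mod_cast hspec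
  have hfp : ∀ p ∈ T, ((m p).factorial : ℝ) ≠ 0 := fun p _ => by positivity
  have hlog : Real.log (ℓ.factorial : ℝ) =
      ∑ p ∈ T, Real.log ((m p).factorial : ℝ) + Real.log (Nat.multinomial T m : ℝ) := by
    rw [← hspec', Real.log_mul (Finset.prod_ne_zero_iff.mpr hfp) hmul.ne', Real.log_prod hfp]
  have hterm : Real.log (term T b m) = Real.log (Nat.multinomial T m : ℝ) +
      ∑ p ∈ T, (m p : ℝ) * Real.log (b p) := by
    unfold term
    rw [Real.log_mul hmul.ne' hprod.ne', Real.log_prod (fun p hp => (hpw p hp).ne')]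
    simp [Real.log_pow]
  have hms : ∑ p ∈ T, (m p : ℝ) = ℓ := by exact_mod_cast hm
  have hF : (ℓ : ℝ) * F T b (fun p => (m p : ℝ) / ℓ) =
      ∑ p ∈ T, (m p : ℝ) * Real.log (b p) - ∑ p ∈ T, (m p : ℝ) * Real.log (m p)
        + ℓ * Real.log ℓ := by
    have : (ℓ : ℝ) * Real.log ℓ = ∑ p ∈ T, (m p : ℝ) * Real.log ℓ := by
      rw [← Finset.sum_mul, hms]
    rw [this, F, Finset.mul_sum, ← Finset.sum_sub_distrib, ← Finset.sum_add_distrib]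
    refine Finset.sum_congr rfl fun p _ => ?_
    by_cases h : m p = 0
    · simp [h]
    · have h' : (m p : ℝ) ≠ 0 := by exact_mod_cast h
      rw [Real.negMulLog, Real.log_div h' hl'.ne']
      field_simp
      ring
  have hlow : ∑ p ∈ T, ((m p : ℝ) * Real.log (m p) - m p) ≤
      ∑ p ∈ T, Real.log ((m p).factorial : ℝ) :=
    Finset.sum_le_sum fun p _ => (log_factorial_bounds (m p)).1
  have hup : ∑ p ∈ T, Real.log ((m p).factorial : ℝ) ≤
      ∑ p ∈ T, ((m p : ℝ) * Real.log (m p) - m p + (Real.log ((ℓ : ℝ) + 1) + 1)) := by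
    refine Finset.sum_le_sum fun p hp => (log_factorial_bounds (m p)).2.trans ?_
    have h1 : m p ≤ ℓ := hm ▸ Finset.single_le_sum (f := m) (fun _ _ => Nat.zero_le _) hp
    have h2 : (m p : ℝ) ≤ ℓ := by exact_mod_cast h1
    have := Real.log_le_log (by positivity : (0 : ℝ) < (m p : ℝ) + 1)
      (by linarith : (m p : ℝ) + 1 ≤ ℓ + 1)
    linarith
  rw [Finset.sum_sub_distrib, hms] at hlow
  rw [Finset.sum_add_distrib, Finset.sum_sub_distrib, hms, Finset.sum_const, nsmul_eq_mul] at hup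
  have hl1 := log_factorial_bounds ℓ
  refine ⟨mul_pos hmul hprod, ?_, ?_⟩ <;> linarith [hl1.1, hl1.2]

lemma expand (T : Finset (ℕ × ℕ)) (b : ℕ × ℕ → ℝ) (B : MvPolynomial (Fin 2) ℝ)
    (hB : B = ∑ p ∈ T, MvPolynomial.monomial (Finsupp.single 0 p.1 + Finsupp.single 1 p.2) (b p))
    (ℓ u v : ℕ) :
    bivarCoeff (B ^ ℓ) u v = ∑ m ∈ T.piAntidiag ℓ,
      if (∑ p ∈ T, m p * p.1 = u ∧ ∑ p ∈ T, m p * p.2 = v) then term T b m else 0 := by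
  rw [hB, Finset.sum_pow_eq_sum_piAntidiag, bivarCoeff, MvPolynomial.coeff_sum]
  refine Finset.sum_congr rfl fun m _ => ?_
  simp only [MvPolynomial.monomial_pow]
  rw [← MvPolynomial.monomial_sum_prod, ← map_natCast MvPolynomial.C, MvPolynomial.coeff_C_mul,
    MvPolynomial.coeff_monomial]
  have : (∑ p ∈ T, m p • (Finsupp.single (0 : Fin 2) p.1 + Finsupp.single 1 p.2) =
      Finsupp.single 0 u + Finsupp.single 1 v) ↔
      (∑ p ∈ T, m p * p.1 = u ∧ ∑ p ∈ T, m p * p.2 = v) := by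
    rw [Finsupp.ext_iff, Fin.forall_fin_two]
    simp [Finsupp.finsetSum_apply]
  simp only [this, term]
  split_ifs <;> simp

lemma B_eq (T : Finset (ℕ × ℕ)) (B : MvPolynomial (Fin 2) ℝ)
    (hT : ∀ p : ℕ × ℕ, p ∉ T → bivarCoeff B p.1 p.2 = 0) :
    B = ∑ p ∈ T, MvPolynomial.monomial (Finsupp.single 0 p.1 + Finsupp.single 1 p.2)
      (bivarCoeff B p.1 p.2) := by
  ext e
  have he : e = Finsupp.single 0 (e 0) + Finsupp.single 1 (e 1) := by
    rw [Finsupp.ext_iff, Fin.forall_fin_two]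
    simp
  have h1 : MvPolynomial.coeff e B = bivarCoeff B (e 0) (e 1) := by
    rw [bivarCoeff, ← he]
  rw [h1, MvPolynomial.coeff_sum]
  simp only [MvPolynomial.coeff_monomial]
  have : ∀ p : ℕ × ℕ, (Finsupp.single (0 : Fin 2) p.1 + Finsupp.single 1 p.2 = e) ↔
      p = (e 0, e 1) := by
    intro p
    rw [Finsupp.ext_iff, Fin.forall_fin_two, Prod.ext_iff]
    simp
  simp only [this]
  rw [Finset.sum_ite_eq']
  split_ifs with h
  · rfl
  · exact hT _ h

lemma card_le (T : Finset (ℕ × ℕ)) (ℓ : ℕ) : (T.piAntidiag ℓ).card ≤ (ℓ + 1) ^ T.card := by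
  have : (T.pi fun _ => Finset.range (ℓ + 1)).card = (ℓ + 1) ^ T.card := by
    simp [Finset.card_pi]
  rw [← this]
  refine Finset.card_le_card_of_injOn (fun m p _ => m p) ?_ ?_
  · intro m hm
    simp only [Finset.mem_coe, Finset.mem_piAntidiag] at hm
    simp only [Finset.mem_coe, Finset.mem_pi, Finset.mem_range]
    intro p hp
    exact Nat.lt_succ_of_le (hm.1 ▸ Finset.single_le_sum (f := m) (fun _ _ => Nat.zero_le _) hp)
  · intro m hm m' hm' h
    simp only [Finset.mem_coe, Finset.mem_piAntidiag] at hm hm'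
    funext p
    by_cases hp : p ∈ T
    · exact congrFun (congrFun h p) hp
    · have h1 : m p = 0 := by by_contra h0; exact hp (hm.2 p h0)
      have h2 : m' p = 0 := by by_contra h0; exact hp (hm'.2 p h0)
      rw [h1, h2]

/-- simultaneous Dirichlet approximation -/
lemma dirichlet (T : Finset (ℕ × ℕ)) (x : ℕ × ℕ → ℝ) (δ : ℝ) (hδ : 0 < δ) (n₀ : ℕ) :
    ∃ n : ℕ, n₀ ≤ n ∧ ∀ p ∈ T, ∃ z : ℤ, |(n : ℝ) * x p - z| < δ := by
  let y : T → UnitAddCircle := fun p => ((x p : ℝ) : UnitAddCircle)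
  have h := mapClusterPt_zero_atTop_nsmul y
  have hfreq := h.frequently (p := fun w => w ∈ Metric.ball (0 : T → UnitAddCircle) δ)
    (Metric.ball_mem_nhds _ hδ)
  obtain ⟨n, hn, hball⟩ := (Filter.frequently_atTop.mp hfreq) n₀
  refine ⟨n, hn, fun p hp => ⟨round ((n : ℝ) * x p), ?_⟩⟩
  rw [mem_ball_zero_iff, pi_norm_lt_iff hδ] at hball
  have h2 := hball ⟨p, hp⟩
  rw [← UnitAddCircle.norm_eq]
  have e : (((n : ℝ) * x p : ℝ) : UnitAddCircle) = n • ((x p : ℝ) : UnitAddCircle) := by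
    rw [← AddCircle.coe_nsmul, nsmul_eq_mul]
  rw [e]
  exact h2

end BM

namespace BM

lemma nat_of_den (q : ℚ) (h0 : 0 ≤ q) (h : q.den = 1) : ∃ u : ℕ, q = u := by
  refine ⟨q.num.toNat, ?_⟩
  have h1 : (q.num.toNat : ℤ) = q.num := Int.toNat_of_nonneg (Rat.num_nonneg.mpr h0)
  have h2 : ((q.num : ℤ) : ℚ) = q := Rat.coe_int_num_of_den_eq_one h
  calc q = ((q.num : ℤ) : ℚ) := h2.symm
    _ = (((q.num.toNat : ℕ) : ℤ) : ℚ) := by rw [h1]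
    _ = _ := by push_cast; rfl

lemma round_eq (T : Finset (ℕ × ℕ)) (w : ℕ × ℕ → ℕ) (x : ℕ × ℕ → ℝ) (m : ℕ × ℕ → ℕ) (u : ℕ)
    (δ : ℝ) (hx : ∑ p ∈ T, (w p : ℝ) * x p = u) (hm : ∀ p ∈ T, |x p - m p| ≤ δ)
    (hδ : (∑ p ∈ T, (w p : ℝ)) * δ < 1) : ∑ p ∈ T, m p * w p = u := by
  have h1 : |(u : ℝ) - ∑ p ∈ T, (m p : ℝ) * w p| < 1 := by
    rw [← hx, ← Finset.sum_sub_distrib]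
    refine (Finset.abs_sum_le_sum_abs _ _).trans_lt (lt_of_le_of_lt ?_ hδ)
    rw [Finset.sum_mul]
    refine Finset.sum_le_sum fun p hp => ?_
    have : (w p : ℝ) * x p - m p * w p = w p * (x p - m p) := by ring
    rw [this, abs_mul, abs_of_nonneg (by positivity : (0 : ℝ) ≤ w p)]
    exact mul_le_mul_of_nonneg_left (hm p hp) (by positivity)
  have h2 : |(u : ℤ) - ((∑ p ∈ T, m p * w p : ℕ) : ℤ)| < 1 := by
    have : ((|(u : ℤ) - ((∑ p ∈ T, m p * w p : ℕ) : ℤ)| : ℤ) : ℝ) < ((1 : ℤ) : ℝ) := by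
      push_cast
      exact h1
    exact_mod_cast this
  have h3 := Int.abs_lt_one_iff.mp h2
  omega

lemma approx (T : Finset (ℕ × ℕ)) (η : ℕ × ℕ → ℝ) (ξ θ : ℚ) (hξ : 0 < ξ) (hθ : 0 < θ)
    (h0 : ∀ p, 0 ≤ η p) (h1 : ∑ p ∈ T, η p = 1)
    (h2 : ∑ p ∈ T, (p.1 : ℝ) * η p = (ξ : ℝ)) (h3 : ∑ p ∈ T, (p.2 : ℝ) * η p = (θ : ℝ))
    (n₀ : ℕ) :
    ∃ (N u v : ℕ) (m : ℕ × ℕ → ℕ), n₀ ≤ N ∧ 0 < N ∧ ξ * (N : ℚ) = u ∧ θ * (N : ℚ) = v ∧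
      ∑ p ∈ T, m p = N ∧ ∑ p ∈ T, m p * p.1 = u ∧ ∑ p ∈ T, m p * p.2 = v ∧
      (∀ p, p ∉ T → m p = 0) ∧ (∀ p ∈ T, |(N : ℝ) * η p - m p| ≤ 1) ∧
      (∀ p, η p = 0 → m p = 0) := by
  classical
  set D : ℕ := ξ.den * θ.den with hD
  have hDpos : 0 < D := Nat.mul_pos ξ.den_pos θ.den_pos
  set W : ℝ := ∑ p ∈ T, (1 + (p.1 : ℝ) + p.2) with hW
  have hW0 : 0 ≤ W := Finset.sum_nonneg fun p _ => by positivity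
  set δ : ℝ := 1 / (W + 1) with hδdef
  have hδ : 0 < δ := by positivity
  have hδ1 : δ ≤ 1 := by rw [hδdef, div_le_one (by positivity)]; linarith
  have hWδ : W * δ < 1 := by rw [hδdef, mul_one_div, div_lt_one (by positivity)]; linarith
  obtain ⟨n, hn, hz⟩ := dirichlet T (fun p => (D : ℝ) * η p) δ hδ (n₀ + 1)
  choose! z hz using hz
  have hNpos : 0 < n * D := Nat.mul_pos (by omega) hDpos
  have hle : n₀ ≤ n * D := by nlinarith
  have hξN : 0 ≤ ξ * ((n * D : ℕ) : ℚ) := by positivity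
  have hθN : 0 ≤ θ * ((n * D : ℕ) : ℚ) := by positivity
  have hξd : (ξ * ((n * D : ℕ) : ℚ)).den = 1 := by
    have : ξ * ((n * D : ℕ) : ℚ) = ((ξ.num * n * θ.den : ℤ) : ℚ) := by
      conv_lhs => rw [← Rat.num_div_den ξ]
      have : (ξ.den : ℚ) ≠ 0 := by exact_mod_cast ξ.den_nz
      rw [hD]; push_cast; field_simp
    rw [this]; exact Rat.den_intCast _
  have hθd : (θ * ((n * D : ℕ) : ℚ)).den = 1 := by
    have : θ * ((n * D : ℕ) : ℚ) = ((θ.num * n * ξ.den : ℤ) : ℚ) := by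
      conv_lhs => rw [← Rat.num_div_den θ]
      have : (θ.den : ℚ) ≠ 0 := by exact_mod_cast θ.den_nz
      rw [hD]; push_cast; field_simp
    rw [this]; exact Rat.den_intCast _
  obtain ⟨u, hu⟩ := nat_of_den _ hξN hξd
  obtain ⟨v, hv⟩ := nat_of_den _ hθN hθd
  have huR : (ξ : ℝ) * ((n * D : ℕ) : ℝ) = u := by exact_mod_cast congrArg (Rat.cast : ℚ → ℝ) hu
  have hvR : (θ : ℝ) * ((n * D : ℕ) : ℝ) = v := by exact_mod_cast congrArg (Rat.cast : ℚ → ℝ) hv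
  let m : ℕ × ℕ → ℕ := fun p => if p ∈ T then (z p).toNat else 0
  have hmz : ∀ p ∈ T, ((m p : ℕ) : ℝ) = z p := by
    intro p hp
    have hzp := abs_lt.mp (hz p hp)
    have hnn : 0 ≤ (n : ℝ) * ((D : ℝ) * η p) := by have := h0 p; positivity
    have : (-1 : ℝ) < z p := by linarith [hzp.1, hzp.2]
    have h' : (-1 : ℤ) < z p := by exact_mod_cast this
    have h'' : ((z p).toNat : ℤ) = z p := Int.toNat_of_nonneg (by omega)
    simp only [m, if_pos hp]
    exact_mod_cast congrArg (Int.cast : ℤ → ℝ) h''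
  have hmδ : ∀ p ∈ T, |((n * D : ℕ) : ℝ) * η p - m p| ≤ δ := by
    intro p hp
    rw [hmz p hp]
    have := (hz p hp).le
    push_cast
    rwa [mul_assoc]
  have hw : ∀ w : ℕ × ℕ → ℕ, (∀ p, w p ≤ 1 + p.1 + p.2) → (∑ p ∈ T, (w p : ℝ)) * δ < 1 := by
    intro w hw
    refine lt_of_le_of_lt (mul_le_mul_of_nonneg_right (Finset.sum_le_sum fun p _ => ?_) hδ.le) hWδ
    exact_mod_cast hw p
  have hsum : ∀ w : ℕ × ℕ → ℕ, ∑ p ∈ T, (w p : ℝ) * (((n * D : ℕ) : ℝ) * η p) =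
      (∑ p ∈ T, (w p : ℝ) * η p) * ((n * D : ℕ) : ℝ) := by
    intro w
    rw [Finset.sum_mul]
    exact Finset.sum_congr rfl fun p _ => by ring
  refine ⟨n * D, u, v, m, hle, hNpos, hu, hv, ?_, ?_, ?_, ?_, ?_, ?_⟩
  · have := round_eq T (fun _ => 1) (fun p => ((n * D : ℕ) : ℝ) * η p) m (n * D) δ
      (by rw [hsum]; simp [h1]) hmδ (hw _ fun p => by omega)
    simpa using this
  · exact round_eq T (fun p => p.1) (fun p => ((n * D : ℕ) : ℝ) * η p) m u δ
      (by rw [hsum, h2, huR]) hmδ (hw _ fun p => by omega)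
  · exact round_eq T (fun p => p.2) (fun p => ((n * D : ℕ) : ℝ) * η p) m v δ
      (by rw [hsum, h3, hvR]) hmδ (hw _ fun p => by omega)
  · intro p hp; simp [m, hp]
  · intro p hp; exact (hmδ p hp).trans hδ1
  · intro p hp
    by_cases hpT : p ∈ T
    · have h5 := hz p hpT
      simp only [hp, mul_zero, zero_sub, abs_neg] at h5
      have h6 := h5.trans_le hδ1
      have h7 : |z p| < 1 := by exact_mod_cast h6
      have h8 := Int.abs_lt_one_iff.mp h7
      simp [m, h8]
    · simp [m, hpT]

lemma fekete (a : ℕ → ℝ) (L : Set ℕ) (hpos : ∀ ℓ ∈ L, 0 < a ℓ)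
    (hadd : ∀ ℓ ∈ L, ∀ m ∈ L, ℓ + m ∈ L ∧ a ℓ * a m ≤ a (ℓ + m)) (N : ℕ) (hN : N ∈ L)
    (hN0 : 0 < N) :
    ∃ K : ℝ, ∀ ℓ ∈ L, (ℓ : ℝ) * (Real.log (a N) / N) - K ≤ Real.log (a ℓ) := by
  classical
  have hN0' : (0 : ℝ) < N := by exact_mod_cast hN0
  have step : ∀ ρ ∈ L, ∀ t : ℕ, ρ + N * t ∈ L ∧
      Real.log (a ρ) + t * Real.log (a N) ≤ Real.log (a (ρ + N * t)) := by
    intro ρ hρ t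
    induction t with
    | zero => simpa using hρ
    | succ t ih =>
      have h := hadd _ ih.1 _ hN
      have e : ρ + N * (t + 1) = ρ + N * t + N := by ring
      rw [e]
      refine ⟨h.1, ?_⟩
      have h2 := Real.log_le_log (mul_pos (hpos _ ih.1) (hpos _ hN)) h.2
      rw [Real.log_mul (hpos _ ih.1).ne' (hpos _ hN).ne'] at h2
      push_cast
      linarith [ih.2]
  have hr : ∀ r : ℕ, ∃ K : ℝ, ∀ ℓ ∈ L, ℓ % N = r →
      (ℓ : ℝ) * (Real.log (a N) / N) - K ≤ Real.log (a ℓ) := by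
    intro r
    by_cases hex : ∃ ρ, ρ ∈ L ∧ ρ % N = r
    · obtain ⟨hρL, hρr⟩ := Nat.find_spec hex
      set ρ := Nat.find hex
      refine ⟨ρ * (Real.log (a N) / N) - Real.log (a ρ), fun ℓ hℓ hℓr => ?_⟩
      have hle : ρ ≤ ℓ := Nat.find_min' hex ⟨hℓ, hℓr⟩
      have hmod : ρ ≡ ℓ [MOD N] := by rw [Nat.ModEq, hρr, hℓr]
      obtain ⟨t, ht⟩ := (Nat.modEq_iff_dvd' hle).mp hmod
      have hℓe : ℓ = ρ + N * t := by omega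
      have hs := (step ρ hρL t).2
      rw [hℓe]
      push_cast
      have : ((ρ : ℝ) + N * t) * (Real.log (a N) / N) =
        ρ * (Real.log (a N) / N) + t * Real.log (a N) := by field_simp
      rw [this]
      linarith
    · exact ⟨0, fun ℓ hℓ hℓr => (hex ⟨ℓ, hℓ, hℓr⟩).elim⟩
  choose K hK using hr
  refine ⟨∑ r ∈ Finset.range N, |K r|, fun ℓ hℓ => ?_⟩
  have h1 := hK (ℓ % N) ℓ hℓ rfl
  have h2 : |K (ℓ % N)| ≤ ∑ r ∈ Finset.range N, |K r| :=
    Finset.single_le_sum (f := fun r => |K r|) (fun _ _ => abs_nonneg _)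
      (Finset.mem_range.mpr (Nat.mod_lt _ hN0))
  linarith [le_abs_self (K (ℓ % N))]

lemma tendsto_err (C : ℝ) :
    Tendsto (fun n : ℕ => C * (Real.log ((n : ℝ) + 1) + 1) / (n : ℝ)) atTop (𝓝 0) := by
  have h1 : Tendsto (fun n : ℕ => Real.log ((n : ℝ) + 1) / ((n : ℝ) + 1)) atTop (𝓝 0) := by
    have h := Real.isLittleO_log_id_atTop.tendsto_div_nhds_zero
    exact h.comp (tendsto_atTop_add_const_right _ (1 : ℝ) tendsto_natCast_atTop_atTop)
  have h2 : Tendsto (fun n : ℕ => (1 : ℝ) / (n : ℝ)) atTop (𝓝 0) :=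
    tendsto_one_div_atTop_nhds_zero_nat
  have h3 : Tendsto (fun n : ℕ => C * (Real.log ((n : ℝ) + 1) / ((n : ℝ) + 1) * (1 + 1 / (n : ℝ))
      + 1 / (n : ℝ))) atTop (𝓝 (C * (0 * (1 + 0) + 0))) :=
    ((h1.mul (h2.const_add 1)).add h2).const_mul C
  simp only [zero_mul, add_zero, mul_zero] at h3
  refine h3.congr' ?_
  filter_upwards [eventually_gt_atTop 0] with n hn
  have : (0 : ℝ) < n := by exact_mod_cast hn
  field_simp

/-- feasible set -/
def Feas (T : Finset (ℕ × ℕ)) (b : ℕ × ℕ → ℝ) (ξ θ : ℝ) : Set (ℕ × ℕ → ℝ) :=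
  {η | (∀ p, 0 ≤ η p) ∧ (∀ p, ¬ 0 < b p → η p = 0) ∧ (∑ p ∈ T, η p) = 1 ∧
    (∑ p ∈ T, (p.1 : ℝ) * η p) = ξ ∧ (∑ p ∈ T, (p.2 : ℝ) * η p) = θ}

lemma feas_compact (T : Finset (ℕ × ℕ)) (b : ℕ × ℕ → ℝ) (ξ θ : ℝ)
    (hT : ∀ p, p ∉ T → b p = 0) : IsCompact (Feas T b ξ θ) := by
  have hK : IsCompact (Set.pi Set.univ fun _ : ℕ × ℕ => Set.Icc (0 : ℝ) 1) :=
    isCompact_univ_pi fun _ => isCompact_Icc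
  refine hK.of_isClosed_subset ?_ ?_
  · unfold Feas
    refine IsClosed.inter ?_ (IsClosed.inter ?_ (IsClosed.inter ?_ (IsClosed.inter ?_ ?_)))
    · change IsClosed {η : ℕ × ℕ → ℝ | ∀ p, 0 ≤ η p}
      rw [Set.ofPred_forall]
      exact isClosed_iInter fun p => isClosed_le continuous_const (continuous_apply p)
    · change IsClosed {η : ℕ × ℕ → ℝ | ∀ p, ¬ 0 < b p → η p = 0}
      simp only [Set.ofPred_forall]
      exact isClosed_iInter fun p => isClosed_iInter fun _ =>
        isClosed_eq (continuous_apply p) continuous_const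
    · exact isClosed_eq (by fun_prop) continuous_const
    · exact isClosed_eq (by fun_prop) continuous_const
    · exact isClosed_eq (by fun_prop) continuous_const
  · intro η hη p _
    refine ⟨hη.1 p, ?_⟩
    by_cases hp : p ∈ T
    · rw [← hη.2.2.1]
      exact Finset.single_le_sum (f := η) (fun q _ => hη.1 q) hp
    · rw [hη.2.1 p (by rw [hT p hp]; exact lt_irrefl _)]
      exact zero_le_one

lemma feas_of_count (T : Finset (ℕ × ℕ)) (b : ℕ × ℕ → ℝ) (ξ θ : ℚ) (m : ℕ × ℕ → ℕ) (ℓ u v : ℕ)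
    (hl : 0 < ℓ) (hu : ξ * (ℓ : ℚ) = u) (hv : θ * (ℓ : ℚ) = v)
    (h1 : ∑ p ∈ T, m p = ℓ) (h2 : ∑ p ∈ T, m p * p.1 = u) (h3 : ∑ p ∈ T, m p * p.2 = v)
    (hb : ∀ p, m p ≠ 0 → 0 < b p) :
    (fun p => (m p : ℝ) / ℓ) ∈ Feas T b ξ θ := by
  have hl' : (ℓ : ℝ) ≠ 0 := by exact_mod_cast hl.ne'
  have huR : (ξ : ℝ) * (ℓ : ℝ) = u := by exact_mod_cast congrArg (Rat.cast : ℚ → ℝ) hu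
  have hvR : (θ : ℝ) * (ℓ : ℝ) = v := by exact_mod_cast congrArg (Rat.cast : ℚ → ℝ) hv
  refine ⟨fun p => by positivity, fun p hp => ?_, ?_, ?_, ?_⟩
  · have : m p = 0 := by by_contra h; exact hp (hb p h)
    simp [this]
  · rw [← Finset.sum_div, div_eq_one_iff_eq hl']
    exact_mod_cast h1
  · have : ∑ p ∈ T, (p.1 : ℝ) * ((m p : ℝ) / ℓ) = ((∑ p ∈ T, m p * p.1 : ℕ) : ℝ) / ℓ := by
      push_cast; rw [Finset.sum_div]; exact Finset.sum_congr rfl fun p _ => by ring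
    rw [this, h2, ← huR]; field_simp
  · have : ∑ p ∈ T, (p.2 : ℝ) * ((m p : ℝ) / ℓ) = ((∑ p ∈ T, m p * p.2 : ℕ) : ℝ) / ℓ := by
      push_cast; rw [Finset.sum_div]; exact Finset.sum_congr rfl fun p _ => by ring
    rw [this, h3, ← hvR]; field_simp

lemma term_nonneg (T : Finset (ℕ × ℕ)) (b : ℕ × ℕ → ℝ) (hb : ∀ p, 0 ≤ b p) (m : ℕ × ℕ → ℕ) :
    0 ≤ term T b m :=
  mul_nonneg (Nat.cast_nonneg _) (Finset.prod_nonneg fun p _ => pow_nonneg (hb p) _)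

lemma pos_of_term (T : Finset (ℕ × ℕ)) (b : ℕ × ℕ → ℝ) (hb : ∀ p, 0 ≤ b p) (m : ℕ × ℕ → ℕ)
    (hm : ∀ p, m p ≠ 0 → p ∈ T) (h : 0 < term T b m) : ∀ p, m p ≠ 0 → 0 < b p := by
  intro p hp
  refine lt_of_le_of_ne (hb p) fun h0 => h.ne' ?_
  unfold term
  rw [Finset.prod_eq_zero (hm p hp), mul_zero]
  rw [← h0]; exact zero_pow hp

end BM

namespace BM

lemma coeff_pow_nonneg (T : Finset (ℕ × ℕ)) (b : ℕ × ℕ → ℝ) (B : MvPolynomial (Fin 2) ℝ)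
    (hB : B = ∑ p ∈ T, MvPolynomial.monomial (Finsupp.single 0 p.1 + Finsupp.single 1 p.2) (b p))
    (hb : ∀ p, 0 ≤ b p) (ℓ u v : ℕ) : 0 ≤ bivarCoeff (B ^ ℓ) u v := by
  rw [expand T b B hB]
  refine Finset.sum_nonneg fun m _ => ?_
  split_ifs
  · exact term_nonneg T b hb m
  · exact le_rfl

lemma coeff_mul_le (P Q : MvPolynomial (Fin 2) ℝ) (hP : ∀ u v, 0 ≤ bivarCoeff P u v)
    (hQ : ∀ u v, 0 ≤ bivarCoeff Q u v) (u v u' v' : ℕ) :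
    bivarCoeff P u v * bivarCoeff Q u' v' ≤ bivarCoeff (P * Q) (u + u') (v + v') := by
  have hgen : ∀ (R : MvPolynomial (Fin 2) ℝ), (∀ u v, 0 ≤ bivarCoeff R u v) →
      ∀ e, 0 ≤ MvPolynomial.coeff e R := by
    intro R hR e
    have he : e = Finsupp.single 0 (e 0) + Finsupp.single 1 (e 1) := by
      rw [Finsupp.ext_iff, Fin.forall_fin_two]
      simp
    rw [he]
    exact hR _ _
  unfold bivarCoeff
  rw [MvPolynomial.coeff_mul]
  refine Finset.single_le_sum
    (f := fun x : (Fin 2 →₀ ℕ) × (Fin 2 →₀ ℕ) =>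
      MvPolynomial.coeff x.1 P * MvPolynomial.coeff x.2 Q)
    (a := (Finsupp.single 0 u + Finsupp.single 1 v, Finsupp.single 0 u' + Finsupp.single 1 v'))
    (fun x _ => mul_nonneg (hgen P hP _) (hgen Q hQ _)) ?_
  rw [Finset.HasAntidiagonal.mem_antidiagonal]
  rw [Finsupp.single_add, Finsupp.single_add]
  exact add_add_add_comm _ _ _ _

lemma main (T : Finset (ℕ × ℕ)) (b : ℕ × ℕ → ℝ) (B : MvPolynomial (Fin 2) ℝ)
    (hB : B = ∑ p ∈ T, MvPolynomial.monomial (Finsupp.single 0 p.1 + Finsupp.single 1 p.2) (b p))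
    (hb : ∀ p, 0 ≤ b p) (hT : ∀ p, p ∉ T → b p = 0)
    (ξ θ : ℚ) (hξ : 0 < ξ) (hθ : 0 < θ) (L : Set ℕ)
    (hL : L = {ℓ : ℕ | 0 < ℓ ∧ (ξ * (ℓ : ℚ)).den = 1 ∧ (θ * (ℓ : ℚ)).den = 1 ∧
      0 < bivarCoeff (B ^ ℓ) (ξ * (ℓ : ℚ)).num.toNat (θ * (ℓ : ℚ)).num.toNat})
    (hnon : L.Nonempty) :
    ∃ M : ℝ, IsGreatest
        ((fun η : ℕ × ℕ → ℝ => ∑ p ∈ T, η p * Real.log (b p / η p)) '' Feas T b ξ θ) M ∧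
      Tendsto (fun ℓ : ℕ => (1 / (ℓ : ℝ)) *
          Real.log (bivarCoeff (B ^ ℓ) (ξ * (ℓ : ℚ)).num.toNat (θ * (ℓ : ℚ)).num.toNat))
        (atTop ⊓ 𝓟 L) (𝓝 M) := by
  classical
  set a : ℕ → ℝ := fun ℓ => bivarCoeff (B ^ ℓ) (ξ * (ℓ : ℚ)).num.toNat (θ * (ℓ : ℚ)).num.toNat
    with ha
  have hLout : ∀ ℓ ∈ L, 0 < ℓ ∧ 0 < a ℓ ∧ ∃ u v : ℕ, ξ * (ℓ : ℚ) = u ∧ θ * (ℓ : ℚ) = v := by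
    intro ℓ hℓ
    rw [hL] at hℓ
    obtain ⟨u, hu⟩ := nat_of_den (ξ * (ℓ : ℚ)) (by positivity) hℓ.2.1
    obtain ⟨v, hv⟩ := nat_of_den (θ * (ℓ : ℚ)) (by positivity) hℓ.2.2.1
    exact ⟨hℓ.1, hℓ.2.2.2, u, v, hu, hv⟩
  have haeq : ∀ ℓ u v : ℕ, ξ * (ℓ : ℚ) = u → θ * (ℓ : ℚ) = v → a ℓ = bivarCoeff (B ^ ℓ) u v := by
    intro ℓ u v hu hv
    simp only [ha, hu, hv]
    simp
  have hLin : ∀ ℓ u v : ℕ, 0 < ℓ → ξ * (ℓ : ℚ) = u → θ * (ℓ : ℚ) = v → 0 < a ℓ → ℓ ∈ L := by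
    intro ℓ u v h0 hu hv hpos
    rw [hL]
    refine ⟨h0, ?_, ?_, hpos⟩
    · rw [hu]; exact Rat.den_natCast _
    · rw [hv]; exact Rat.den_natCast _
  have hnn := coeff_pow_nonneg T b B hB hb
  -- positive coefficients come from feasible count vectors
  have hex : ∀ ℓ ∈ L, (Feas T b ξ θ).Nonempty := by
    intro ℓ hℓ
    obtain ⟨h0, hpos, u, v, hu, hv⟩ := hLout ℓ hℓ
    rw [haeq ℓ u v hu hv, expand T b B hB] at hpos
    obtain ⟨m, hm, hmpos⟩ : ∃ m ∈ T.piAntidiag ℓ, 0 <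
        (if (∑ p ∈ T, m p * p.1 = u ∧ ∑ p ∈ T, m p * p.2 = v) then term T b m else 0) := by
      by_contra hcon
      push Not at hcon
      exact absurd hpos (not_lt.mpr (Finset.sum_nonpos hcon))
    split_ifs at hmpos with hc
    · rw [Finset.mem_piAntidiag] at hm
      exact ⟨_, feas_of_count T b ξ θ m ℓ u v h0 hu hv hm.1 hc.1 hc.2
        (pos_of_term T b hb m hm.2 hmpos)⟩
    · exact absurd hmpos (lt_irrefl _)
  obtain ⟨ℓ₀, hℓ₀⟩ := hnon
  obtain ⟨ηs, hηs, hmax⟩ := (feas_compact T b ξ θ hT).exists_isMaxOn (hex ℓ₀ hℓ₀)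
    (F_continuous T b).continuousOn
  have hFeq : ∀ η ∈ Feas T b ξ θ, ∑ p ∈ T, η p * Real.log (b p / η p) = F T b η := by
    intro η hη
    exact F_eq T b η fun p hp => hη.2.1 p (by rw [hp]; exact lt_irrefl _)
  set M := F T b ηs with hM
  have hmax' : ∀ η ∈ Feas T b ξ θ, F T b η ≤ M := fun η hη => hmax hη
  refine ⟨M, ⟨⟨ηs, hηs, hFeq ηs hηs⟩, ?_⟩, ?_⟩
  · rintro _ ⟨η, hη, rfl⟩
    change ∑ p ∈ T, η p * Real.log (b p / η p) ≤ M
    rw [hFeq η hη]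
    exact hmax' η hη
  -- upper bound
  have hupper : ∀ ℓ ∈ L, Real.log (a ℓ) ≤
      ℓ * M + ((T.card : ℝ) + 1) * (Real.log ((ℓ : ℝ) + 1) + 1) := by
    intro ℓ hℓ
    obtain ⟨h0, hpos, u, v, hu, hv⟩ := hLout ℓ hℓ
    have h1 : a ℓ ≤ ((ℓ : ℝ) + 1) ^ T.card *
        Real.exp (ℓ * M + (Real.log ((ℓ : ℝ) + 1) + 1)) := by
      rw [haeq ℓ u v hu hv, expand T b B hB]
      have hc := card_le T ℓ
      have hc' : ((T.piAntidiag ℓ).card : ℝ) ≤ ((ℓ : ℝ) + 1) ^ T.card := by exact_mod_cast hc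
      refine (Finset.sum_le_card_nsmul _ _
        (Real.exp (ℓ * M + (Real.log ((ℓ : ℝ) + 1) + 1))) ?_).trans ?_
      · intro m hm
        rw [Finset.mem_piAntidiag] at hm
        split_ifs with hc
        · rcases (term_nonneg T b hb m).eq_or_lt with ht | ht
          · rw [← ht]; exact (Real.exp_pos _).le
          · have hbp := pos_of_term T b hb m hm.2 ht
            have hf := feas_of_count T b ξ θ m ℓ u v h0 hu hv hm.1 hc.1 hc.2 hbp
            have hlt := (log_term T b m ℓ hm.1 h0 fun p _ => hbp p).2.2
            rw [← Real.log_le_iff_le_exp ht]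
            refine hlt.trans ?_
            have := mul_le_mul_of_nonneg_left (hmax' _ hf) (Nat.cast_nonneg (α := ℝ) ℓ)
            linarith
        · exact (Real.exp_pos _).le
      · rw [nsmul_eq_mul]
        exact mul_le_mul_of_nonneg_right hc' (Real.exp_pos _).le
    have h2 := Real.log_le_log hpos h1
    rw [Real.log_mul (by positivity) (Real.exp_pos _).ne', Real.log_exp, Real.log_pow] at h2
    have : (0 : ℝ) ≤ T.card := Nat.cast_nonneg _
    nlinarith
  -- supermultiplicativity
  have hadd : ∀ ℓ ∈ L, ∀ m ∈ L, ℓ + m ∈ L ∧ a ℓ * a m ≤ a (ℓ + m) := by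
    intro ℓ hℓ m hm
    obtain ⟨h0, hpos, u, v, hu, hv⟩ := hLout ℓ hℓ
    obtain ⟨h0', hpos', u', v', hu', hv'⟩ := hLout m hm
    have hu2 : ξ * ((ℓ + m : ℕ) : ℚ) = ((u + u' : ℕ) : ℚ) := by
      push_cast; rw [mul_add, hu, hu']
    have hv2 : θ * ((ℓ + m : ℕ) : ℚ) = ((v + v' : ℕ) : ℚ) := by
      push_cast; rw [mul_add, hv, hv']
    have hle : a ℓ * a m ≤ a (ℓ + m) := by
      rw [haeq ℓ u v hu hv, haeq m u' v' hu' hv', haeq _ _ _ hu2 hv2, pow_add]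
      exact coeff_mul_le _ _ (hnn ℓ) (hnn m) _ _ _ _
    exact ⟨hLin _ _ _ (by omega) hu2 hv2 ((mul_pos hpos hpos').trans_le hle), hle⟩
  -- lower bound
  have hlower : ∀ M' < M, ∃ N ∈ L, 0 < N ∧ M' < Real.log (a N) / N := by
    intro M' hM'
    have happ := fun n => approx T ηs ξ θ hξ hθ hηs.1 hηs.2.2.1 hηs.2.2.2.1 hηs.2.2.2.2 n
    choose N u v m hNn hN0 hu hv h1 h2 h3 hmT hmη hm0 using happ
    have hNtop : Tendsto N atTop atTop := tendsto_atTop_mono hNn tendsto_id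
    have hconv : Tendsto (fun n => (fun p => (m n p : ℝ) / (N n : ℝ))) atTop (𝓝 ηs) := by
      rw [tendsto_pi_nhds]
      intro p
      by_cases hp : p ∈ T
      · rw [tendsto_iff_dist_tendsto_zero]
        have hz : Tendsto (fun n => (1 : ℝ) / (N n : ℝ)) atTop (𝓝 0) :=
          tendsto_one_div_atTop_nhds_zero_nat.comp hNtop
        refine squeeze_zero (fun _ => dist_nonneg) (fun n => ?_) hz
        have hNp : (0 : ℝ) < N n := by exact_mod_cast hN0 n
        rw [dist_comm, Real.dist_eq, le_div_iff₀ hNp]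
        calc |ηs p - (m n p : ℝ) / N n| * N n = |(ηs p - (m n p : ℝ) / N n) * N n| := by
              rw [abs_mul, abs_of_pos hNp]
          _ = |(N n : ℝ) * ηs p - m n p| := by congr 1; field_simp
          _ ≤ 1 := hmη n p hp
      · have h5 : ηs p = 0 := hηs.2.1 p (by rw [hT p hp]; exact lt_irrefl _)
        simp [hmT _ p hp, h5]
    have hF := ((F_continuous T b).tendsto ηs).comp hconv
    have herr := (tendsto_err (T.card : ℝ)).comp hNtop
    have hsub := hF.sub herr
    rw [sub_zero] at hsub
    obtain ⟨n, hn⟩ := (hsub.eventually (lt_mem_nhds hM')).exists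
    have hNp : (0 : ℝ) < N n := by exact_mod_cast hN0 n
    have hbp : ∀ p, m n p ≠ 0 → 0 < b p := by
      intro p hp
      by_contra hcon
      exact hp (hm0 n p (hηs.2.1 p hcon))
    have hlt := log_term T b (m n) (N n) (h1 n) (hN0 n) fun p _ => hbp p
    have hge : term T b (m n) ≤ a (N n) := by
      rw [haeq _ _ _ (hu n) (hv n), expand T b B hB]
      have hmem : m n ∈ T.piAntidiag (N n) := by
        rw [Finset.mem_piAntidiag]
        refine ⟨h1 n, fun p hp => ?_⟩
        by_contra hcon
        exact hp (hmT n p hcon)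
      have := Finset.single_le_sum (s := T.piAntidiag (N n))
        (f := fun m' => if (∑ p ∈ T, m' p * p.1 = u n ∧ ∑ p ∈ T, m' p * p.2 = v n)
          then term T b m' else 0)
        (fun m' _ => by
          split_ifs
          · exact term_nonneg T b hb m'
          · exact le_rfl) hmem
      simpa [h2 n, h3 n] using this
    refine ⟨N n, hLin _ _ _ (hN0 n) (hu n) (hv n) (hlt.1.trans_le hge), hN0 n, hn.trans_le ?_⟩
    have h6 := Real.log_le_log hlt.1 hge
    simp only [Function.comp_apply]
    rw [le_div_iff₀ hNp, sub_mul, div_mul_cancel₀ _ hNp.ne']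
    linarith [hlt.2.1]
  -- conclusion
  have hgoal : ∀ P : ℕ → Prop, (∀ᶠ ℓ in atTop, ℓ ∈ L → P ℓ) → ∀ᶠ ℓ in atTop ⊓ 𝓟 L, P ℓ := by
    intro P h
    rwa [eventually_inf_principal]
  rw [tendsto_order]
  constructor
  · intro M' hM'
    obtain ⟨N, hN, hN0, hlt⟩ := hlower M' hM'
    obtain ⟨K, hK⟩ := fekete a L (fun ℓ hℓ => (hLout ℓ hℓ).2.1) hadd N hN hN0
    refine hgoal _ ?_
    have ht : Tendsto (fun n : ℕ => Real.log (a N) / N - K / (n : ℝ)) atTop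
        (𝓝 (Real.log (a N) / N - 0)) :=
      (tendsto_const_div_atTop_nhds_zero_nat K).const_sub _
    rw [sub_zero] at ht
    filter_upwards [ht.eventually (lt_mem_nhds hlt), eventually_gt_atTop 0] with ℓ h1 h2 hℓ
    have hp : (0 : ℝ) < ℓ := by exact_mod_cast h2
    refine h1.trans_le ?_
    have h3 := hK ℓ hℓ
    change _ ≤ (1 / (ℓ : ℝ)) * Real.log (a ℓ)
    rw [one_div_mul_eq_div, le_div_iff₀ hp, sub_mul, div_mul_cancel₀ _ hp.ne']
    linarith
  · intro M' hM'
    refine hgoal _ ?_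
    have ht := (tendsto_err ((T.card : ℝ) + 1)).const_add M
    rw [add_zero] at ht
    filter_upwards [ht.eventually (gt_mem_nhds hM'), eventually_gt_atTop 0] with ℓ h1 h2 hℓ
    have hp : (0 : ℝ) < ℓ := by exact_mod_cast h2
    refine lt_of_le_of_lt ?_ h1
    have h3 := hupper ℓ hℓ
    change (1 / (ℓ : ℝ)) * Real.log (a ℓ) ≤ _
    rw [one_div_mul_eq_div, div_le_iff₀ hp, add_mul, div_mul_cancel₀ _ hp.ne']
    linarith

end BM

/-- Burshtein–Miller: Let
`B(x,y) = 1 + ∑_{u=1}^{k} ∑_{v=c}^{d} B_{u,v} x^u y^v` with `k ≥ 1`, `1 ≤ c ≤ d` and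
`B_{u,v} ≥ 0`. Fix positive rationals `ξ, θ` and suppose the set of positive integers `ℓ`
with `ξℓ ∈ ℤ`, `θℓ ∈ ℤ` and `Coeff[(B(x,y))^ℓ, x^{ξℓ} y^{θℓ}] > 0` is nonempty. Then
`lim_{ℓ→∞} (1/ℓ) log Coeff[(B(x,y))^ℓ, x^{ξℓ} y^{θℓ}]` (along those `ℓ`) exists and
equals the maximum of `∑_{(i,j)∈S} η_{i,j} log(B_{i,j}/η_{i,j})` subject to
`∑ η_{i,j} = 1`, `∑ i η_{i,j} = ξ`, `∑ j η_{i,j} = θ`, `η_{i,j} ≥ 0`, where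
`S = {(i,j) : B_{i,j} > 0}` (vectors indexed by `S` are modelled as functions
`η : ℕ × ℕ → ℝ` vanishing off `S`; the convention `0 · log(B/0) = 0` holds
automatically in Lean). -/
theorem bivariate_coeff_power_growth_eq_max_entropy
    (k c d : ℕ) (hk : 1 ≤ k) (hc : 1 ≤ c) (hcd : c ≤ d)
    (B : MvPolynomial (Fin 2) ℝ)
    (h00 : bivarCoeff B 0 0 = 1)
    (hnonneg : ∀ u v : ℕ, 1 ≤ u → u ≤ k → c ≤ v → v ≤ d → 0 ≤ bivarCoeff B u v)
    (hform : ∀ u v : ℕ, ¬(u = 0 ∧ v = 0) →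
      ¬(1 ≤ u ∧ u ≤ k ∧ c ≤ v ∧ v ≤ d) → bivarCoeff B u v = 0)
    (ξ θ : ℚ) (hξ : 0 < ξ) (hθ : 0 < θ)
    (hnon : ({ℓ : ℕ | 0 < ℓ ∧ (ξ * (ℓ : ℚ)).den = 1 ∧ (θ * (ℓ : ℚ)).den = 1 ∧
      0 < bivarCoeff (B ^ ℓ) (ξ * (ℓ : ℚ)).num.toNat (θ * (ℓ : ℚ)).num.toNat}).Nonempty) :
    ∃ M : ℝ,
      IsGreatest
        ((fun η : ℕ × ℕ → ℝ =>
            ∑ p ∈ Finset.range (k + 1) ×ˢ Finset.range (d + 1),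
              η p * Real.log (bivarCoeff B p.1 p.2 / η p)) ''
          {η : ℕ × ℕ → ℝ |
            (∀ p, 0 ≤ η p) ∧
            (∀ p : ℕ × ℕ, ¬ 0 < bivarCoeff B p.1 p.2 → η p = 0) ∧
            (∑ p ∈ Finset.range (k + 1) ×ˢ Finset.range (d + 1), η p) = 1 ∧
            (∑ p ∈ Finset.range (k + 1) ×ˢ Finset.range (d + 1), (p.1 : ℝ) * η p) = (ξ : ℝ) ∧
            (∑ p ∈ Finset.range (k + 1) ×ˢ Finset.range (d + 1), (p.2 : ℝ) * η p) = (θ : ℝ)}) M ∧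
      Tendsto
        (fun ℓ : ℕ => (1 / (ℓ : ℝ)) *
          Real.log (bivarCoeff (B ^ ℓ) (ξ * (ℓ : ℚ)).num.toNat (θ * (ℓ : ℚ)).num.toNat))
        (atTop ⊓ 𝓟 {ℓ : ℕ | 0 < ℓ ∧ (ξ * (ℓ : ℚ)).den = 1 ∧ (θ * (ℓ : ℚ)).den = 1 ∧
          0 < bivarCoeff (B ^ ℓ) (ξ * (ℓ : ℚ)).num.toNat (θ * (ℓ : ℚ)).num.toNat})
        (𝓝 M) := by
  have hT : ∀ p : ℕ × ℕ, p ∉ Finset.range (k + 1) ×ˢ Finset.range (d + 1) →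
      bivarCoeff B p.1 p.2 = 0 := by
    intro p hp
    simp only [Finset.mem_product, Finset.mem_range] at hp
    apply hform <;> omega
  have hb : ∀ p : ℕ × ℕ, 0 ≤ bivarCoeff B p.1 p.2 := by
    intro p
    by_cases h0 : p.1 = 0 ∧ p.2 = 0
    · rw [h0.1, h0.2, h00]; exact zero_le_one
    · by_cases h1 : 1 ≤ p.1 ∧ p.1 ≤ k ∧ c ≤ p.2 ∧ p.2 ≤ d
      · exact hnonneg _ _ h1.1 h1.2.1 h1.2.2.1 h1.2.2.2
      · exact (hform _ _ h0 h1).ge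
  exact BM.main (Finset.range (k + 1) ×ˢ Finset.range (d + 1)) (fun p => bivarCoeff B p.1 p.2) B
    (BM.B_eq _ B hT) hb hT ξ θ hξ hθ _ rfl hnon
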